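/- Theorem 2 under mean–median coincidence. Under the sample selection model with Assumptions 1 and 3, integrable Y₀*, Y₁*, continuous strictly increasing conditional CDF F₁ of Y given {D=1, S=1}, the positivity conditions, and Assumption 6 (mean–median coincidence: the mean of the conditional distribution of Y₁* given {S₀ = S₁ = 1} is a median of that distribution, i.e. with m := E[Y₁* | S₀=S₁=1] one has P(Y₁* ≤ m | S₀=S₁=1) ≥ 1/2 and P(Y₁* ≥ m | S₀=S₁=1) ≥ 1/2), it holds that y¹_{ϑq₀/2} − E[Y | D=0, S=1] ≤ τ ≤ y¹_{1−ϑq₀/2} − E[Y | D=0, S=1]. -/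

import Mathlib

open MeasureTheory ProbabilityTheory Set

noncomputable section

variable {Ω : Type*} [MeasurableSpace Ω]

/-- Probability of an event as a real number. -/
def pr (μ : Measure Ω) (A : Set Ω) : ℝ := (μ A).toReal

/-- Conditional probability `P(B | A)`. -/
def cpr (μ : Measure Ω) (A B : Set Ω) : ℝ := pr μ (A ∩ B) / pr μ A

/-- Conditional expectation of `X` given the event `A`. -/
def cexp (μ : Measure Ω) (X : Ω → ℝ) (A : Set Ω) : ℝ := (∫ ω in A, X ω ∂μ) / pr μ A

lemma setInt_indep (μ : Measure Ω) [IsProbabilityMeasure μ] (X Z : Ω → ℝ) (c : ℝ)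
    (hX : AEStronglyMeasurable X μ) (hZ : Measurable Z) (h : IndepFun X Z μ) :
    ∫ ω in {ω | Z ω = c}, X ω ∂μ = (∫ ω, X ω ∂μ) * μ.real {ω | Z ω = c} := by
  have hms : MeasurableSet {ω | Z ω = c} := hZ (measurableSet_singleton c)
  have hphi : Measurable (Set.indicator {c} (fun _ : ℝ => (1 : ℝ))) :=
    measurable_const.indicator (measurableSet_singleton c)
  have h2 := h.comp measurable_id hphi
  have h3 := h2.integral_fun_mul_eq_mul_integral hX (hphi.comp hZ).aestronglyMeasurable
  have e : (fun ω => (Set.indicator {c} (fun _ : ℝ => (1 : ℝ)) ∘ Z) ω)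
      = Set.indicator {ω | Z ω = c} (fun _ => (1 : ℝ)) := by
    ext ω
    by_cases hc : Z ω = c <;> simp [Set.indicator, hc]
  have e2 : (fun ω => (id ∘ X) ω * (Set.indicator {c} (fun _ : ℝ => (1 : ℝ)) ∘ Z) ω)
      = Set.indicator {ω | Z ω = c} X := by
    ext ω
    by_cases hc : Z ω = c <;> simp [Set.indicator, hc]
  rw [e2] at h3
  rw [← integral_indicator hms, h3]
  congr 1
  change ∫ ω, (fun ω => (Set.indicator {c} (fun _ : ℝ => (1 : ℝ)) ∘ Z) ω) ω ∂μ = _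
  rw [e, integral_indicator hms]
  simp

/-- The distribution function of `X` on the event `A` vanishes at minus infinity. -/
lemma tendsto_sub_cdf (μ : Measure Ω) [IsProbabilityMeasure μ] (X : Ω → ℝ) (hX : Measurable X)
    (A : Set Ω) (hA : MeasurableSet A) (e : ℝ) (he : 0 < e) :
    (∃ t, μ.real (A ∩ {ω | X ω ≤ t}) < e) ∧ (∃ t, μ.real A - e < μ.real (A ∩ {ω | X ω ≤ t})) := by
  have key : ∀ t, μ.real (A ∩ {ω | X ω ≤ t}) = ((μ.restrict A).map X).real (Iic t) := by
    intro t
    rw [map_measureReal_apply hX measurableSet_Iic,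
      measureReal_restrict_apply (hX measurableSet_Iic), Set.inter_comm]
    rfl
  have tot : μ.real A = ((μ.restrict A).map X).real univ := by
    rw [map_measureReal_apply hX MeasurableSet.univ]
    simp
  have hb := tendsto_measure_iInter_atBot (μ := (μ.restrict A).map X) (s := fun t : ℝ => Iic t)
    (fun _ => measurableSet_Iic.nullMeasurableSet) (fun a b h => Iic_subset_Iic.2 h)
    ⟨0, measure_ne_top _ _⟩
  have hemp : (⋂ t : ℝ, Iic t) = ∅ := iInter_Iic_eq_empty_iff.2 (by simp)
  rw [hemp, measure_empty] at hb
  have ht := tendsto_measure_Iic_atTop ((μ.restrict A).map X)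
  have hb' := (ENNReal.tendsto_toReal (by simp)).comp hb
  have ht' := (ENNReal.tendsto_toReal (measure_ne_top _ _)).comp ht
  constructor
  · obtain ⟨t, h⟩ := (hb'.eventually_lt_const (u := e) (by simpa using he)).exists
    exact ⟨t, by rw [key]; exact h⟩
  · obtain ⟨t, h⟩ := ((ht'.eventually_const_lt (u := μ.real A - e)
      (by rw [tot]; simp only [measureReal_def]; linarith))).exists
    exact ⟨t, by rw [key]; exact h⟩

/-- **Theorem 2 under mean–median coincidence.** Under the sample selection model with
Assumptions 1, 3 and the mean–median coincidence assumption (Assumption 6), `τ` lies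
between `y¹_{ϑq₀/2} − E[Y | D=0, S=1]` and `y¹_{1−ϑq₀/2} − E[Y | D=0, S=1]`. -/
theorem lee_bounds_mean_median_validity
    (μ : Measure Ω) [IsProbabilityMeasure μ]
    (Y1 Y0 S1 S0 D S Y : Ω → ℝ)
    (hY1m : Measurable Y1) (hY0m : Measurable Y0)
    (hS1m : Measurable S1) (hS0m : Measurable S0) (hDm : Measurable D)
    (hS1v : ∀ ω, S1 ω = 0 ∨ S1 ω = 1) (hS0v : ∀ ω, S0 ω = 0 ∨ S0 ω = 1)
    (hDv : ∀ ω, D ω = 0 ∨ D ω = 1)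
    (hS : ∀ ω, S ω = S1 ω * D ω + S0 ω * (1 - D ω))
    (hY : ∀ ω, Y ω = S ω * (Y1 ω * D ω + Y0 ω * (1 - D ω)))
    (hY1i : Integrable Y1 μ) (hY0i : Integrable Y0 μ)
    -- Assumption 1 (independent assignment)
    (hIndep : IndepFun (fun ω => (Y1 ω, Y0 ω, S1 ω, S0 ω)) D μ)
    -- Assumption 3 (stochastic monotonicity)
    (ϑL : ℝ) (hϑL : ϑL ∈ Set.Ioc (0 : ℝ) 1)
    (hSM1 : ϑL ≤ cpr μ {ω | S0 ω = 1} {ω | S1 ω = 1})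
    (hSM2 : IndepFun (fun ω => (Y1 ω, Y0 ω)) S1 (μ[|{ω | S0 ω = 1}]))
    -- identified quantities
    (α0 q0 ϑF ϑ τ : ℝ) (F1 : ℝ → ℝ) (yq : ℝ → ℝ)
    (hα0 : α0 = cpr μ {ω | D ω = 0} {ω | S ω = 1})
    (hq0 : q0 = cpr μ {ω | D ω = 0} {ω | S ω = 1} / cpr μ {ω | D ω = 1} {ω | S ω = 1})
    (hϑF : ϑF = 1 + 1 / q0 - 1 / α0)
    (hϑ : ϑ = max ϑL ϑF)
    (hF1 : ∀ t, F1 t = cpr μ {ω | D ω = 1 ∧ S ω = 1} {ω | Y ω ≤ t})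
    (hyq : ∀ r, yq r = sInf {t : ℝ | r ≤ F1 t})
    (hF1cont : Continuous F1) (hF1mono : StrictMono F1)
    (hτ : τ = cexp μ (fun ω => Y1 ω - Y0 ω) {ω | S0 ω = 1 ∧ S1 ω = 1})
    -- positivity conditions
    (hD1 : 0 < pr μ {ω | D ω = 1}) (hD1' : pr μ {ω | D ω = 1} < 1)
    (hSD0 : 0 < pr μ {ω | S ω = 1 ∧ D ω = 0})
    (hSD1 : 0 < pr μ {ω | S ω = 1 ∧ D ω = 1})
    (hAT : 0 < pr μ {ω | S0 ω = 1 ∧ S1 ω = 1}) -- Assumption 6 (mean–median coincidence)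
    (m : ℝ) (hm : m = cexp μ Y1 {ω | S0 ω = 1 ∧ S1 ω = 1})
    (hmed1 : 1 / 2 ≤ cpr μ {ω | S0 ω = 1 ∧ S1 ω = 1} {ω | Y1 ω ≤ m})
    (hmed2 : 1 / 2 ≤ cpr μ {ω | S0 ω = 1 ∧ S1 ω = 1} {ω | m ≤ Y1 ω}) :
    yq (ϑ * q0 / 2) - cexp μ Y {ω | D ω = 0 ∧ S ω = 1} ≤ τ ∧
      τ ≤ yq (1 - ϑ * q0 / 2) - cexp μ Y {ω | D ω = 0 ∧ S ω = 1} := by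
  have hprr : ∀ A : Set Ω, pr μ A = μ.real A := fun _ => rfl
  have mS1 : MeasurableSet {ω | S1 ω = 1} := hS1m (measurableSet_singleton 1)
  have mS0 : MeasurableSet {ω | S0 ω = 1} := hS0m (measurableSet_singleton 1)
  have mD1 : MeasurableSet {ω | D ω = 1} := hDm (measurableSet_singleton 1)
  have mD0 : MeasurableSet {ω | D ω = 0} := hDm (measurableSet_singleton 0)
  have mAT : MeasurableSet {ω | S0 ω = 1 ∧ S1 ω = 1} := mS0.inter mS1
  -- independence on events
  have ind : ∀ (B : Set (ℝ × ℝ × ℝ × ℝ)) (d : ℝ), MeasurableSet B →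
      μ.real ({ω | D ω = d} ∩ {ω | (Y1 ω, Y0 ω, S1 ω, S0 ω) ∈ B})
        = μ.real {ω | D ω = d} * μ.real {ω | (Y1 ω, Y0 ω, S1 ω, S0 ω) ∈ B} := by
    intro B d hB
    have := hIndep.measure_inter_preimage_eq_mul B {d} hB (measurableSet_singleton d)
    rw [Set.inter_comm, mul_comm]
    simp only [measureReal_def]
    rw [← ENNReal.toReal_mul]
    exact congrArg ENNReal.toReal this
  have bS1 : MeasurableSet {x : ℝ × ℝ × ℝ × ℝ | x.2.2.1 = 1} :=
    (by fun_prop : Measurable fun x : ℝ × ℝ × ℝ × ℝ => x.2.2.1) (measurableSet_singleton 1)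
  have bS0 : MeasurableSet {x : ℝ × ℝ × ℝ × ℝ | x.2.2.2 = 1} :=
    (by fun_prop : Measurable fun x : ℝ × ℝ × ℝ × ℝ => x.2.2.2) (measurableSet_singleton 1)
  have bY : ∀ t : ℝ, MeasurableSet {x : ℝ × ℝ × ℝ × ℝ | x.1 ≤ t} := fun t =>
    (by fun_prop : Measurable fun x : ℝ × ℝ × ℝ × ℝ => x.1) measurableSet_Iic
  have e0 : {ω | D ω = 0} ∩ {ω | S ω = 1} = {ω | D ω = 0} ∩ {ω | S0 ω = 1} := by
    ext ω
    simp only [mem_inter_iff, mem_ofPred_eq, hS]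
    refine and_congr_right fun h => ?_
    simp [h]
  have e1 : {ω | D ω = 1} ∩ {ω | S ω = 1} = {ω | D ω = 1} ∩ {ω | S1 ω = 1} := by
    ext ω
    simp only [mem_inter_iff, mem_ofPred_eq, hS]
    refine and_congr_right fun h => ?_
    simp [h]
  have eY : ∀ t, {ω | D ω = 1 ∧ S ω = 1} ∩ {ω | Y ω ≤ t}
      = {ω | D ω = 1} ∩ ({ω | S1 ω = 1} ∩ {ω | Y1 ω ≤ t}) := by
    intro t
    ext ω
    simp only [mem_inter_iff, mem_ofPred_eq, hY, hS, and_assoc]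
    refine and_congr_right fun h => ?_
    simp only [h, mul_one, sub_self, mul_zero, add_zero]
    refine and_congr_right fun h => ?_
    simp [h]
  have i0 : μ.real ({ω | D ω = 0} ∩ {ω | S0 ω = 1}) = μ.real {ω | D ω = 0} * μ.real {ω | S0 ω = 1} :=
    ind _ 0 bS0
  have i1 : μ.real ({ω | D ω = 1} ∩ {ω | S1 ω = 1}) = μ.real {ω | D ω = 1} * μ.real {ω | S1 ω = 1} :=
    ind _ 1 bS1
  have iY : ∀ t, μ.real ({ω | D ω = 1} ∩ ({ω | S1 ω = 1} ∩ {ω | Y1 ω ≤ t}))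
      = μ.real {ω | D ω = 1} * μ.real ({ω | S1 ω = 1} ∩ {ω | Y1 ω ≤ t}) :=
    fun t => ind _ 1 (bS1.inter (bY t))
  have c0 : {ω | S ω = 1 ∧ D ω = 0} = {ω | D ω = 0} ∩ {ω | S ω = 1} := Set.inter_comm _ _
  have c1 : {ω | S ω = 1 ∧ D ω = 1} = {ω | D ω = 1} ∩ {ω | S ω = 1} := Set.inter_comm _ _
  rw [c0, e0, hprr, i0] at hSD0
  rw [c1, e1, hprr, i1] at hSD1
  have hd0 : 0 < μ.real {ω | D ω = 0} :=
    lt_of_le_of_ne measureReal_nonneg (by rintro h; rw [← h] at hSD0; simp at hSD0)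
  have hp0 : 0 < μ.real {ω | S0 ω = 1} := pos_of_mul_pos_right hSD0 hd0.le
  have hd1 : 0 < μ.real {ω | D ω = 1} := hD1
  have hp1 : 0 < μ.real {ω | S1 ω = 1} := pos_of_mul_pos_right hSD1 hd1.le
  have k0 : cpr μ {ω | D ω = 0} {ω | S ω = 1} = μ.real {ω | S0 ω = 1} := by
    rw [cpr, hprr, hprr, e0, i0]; field_simp
  have k1 : cpr μ {ω | D ω = 1} {ω | S ω = 1} = μ.real {ω | S1 ω = 1} := by
    rw [cpr, hprr, hprr, e1, i1]; field_simp
  have kF : ∀ t, F1 t = μ.real ({ω | S1 ω = 1} ∩ {ω | Y1 ω ≤ t}) / μ.real {ω | S1 ω = 1} := by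
    intro t
    have : {ω | D ω = 1 ∧ S ω = 1} = {ω | D ω = 1} ∩ {ω | S1 ω = 1} := e1
    rw [hF1, cpr, hprr, hprr, eY, iY, this, i1]; field_simp
  rw [k0] at hα0
  rw [k0, k1] at hq0
  -- the always-takers probability
  have eAT : {ω | S0 ω = 1 ∧ S1 ω = 1} = {ω | S0 ω = 1} ∩ {ω | S1 ω = 1} := rfl
  have frechet : μ.real {ω | S0 ω = 1} + μ.real {ω | S1 ω = 1} - 1
      ≤ μ.real {ω | S0 ω = 1 ∧ S1 ω = 1} := by
    have h1 := measureReal_union_add_inter (μ := μ) (s := {ω | S0 ω = 1}) mS1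
    have h2 : μ.real ({ω | S0 ω = 1} ∪ {ω | S1 ω = 1}) ≤ 1 := measureReal_le_one
    rw [eAT]; linarith
  rw [cpr, hprr, hprr, ← eAT] at hSM1
  rw [hprr] at hAT
  have hϑpos : 0 < ϑ := by rw [hϑ]; exact lt_max_of_lt_left hϑL.1
  have hϑle : ϑ ≤ μ.real {ω | S0 ω = 1 ∧ S1 ω = 1} / μ.real {ω | S0 ω = 1} := by
    rw [hϑ]
    refine max_le hSM1 ?_
    rw [hϑF, hq0, hα0, le_div_iff₀ hp0]
    have : (1 + 1 / (μ.real {ω | S0 ω = 1} / μ.real {ω | S1 ω = 1}) - 1 / μ.real {ω | S0 ω = 1})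
        * μ.real {ω | S0 ω = 1} = μ.real {ω | S0 ω = 1} + μ.real {ω | S1 ω = 1} - 1 := by
      field_simp
    rw [this]; exact frechet
  have hrpos : 0 < ϑ * q0 / 2 := by rw [hq0]; positivity
  have hrle : ϑ * q0 / 2 * μ.real {ω | S1 ω = 1} ≤ μ.real {ω | S0 ω = 1 ∧ S1 ω = 1} / 2 := by
    rw [le_div_iff₀ hp0] at hϑle
    have : ϑ * q0 / 2 * μ.real {ω | S1 ω = 1} = ϑ * μ.real {ω | S0 ω = 1} / 2 := by
      rw [hq0]; field_simp
    rw [this]; linarith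
  rw [cpr, hprr, hprr, le_div_iff₀ hAT] at hmed1 hmed2
  have hsc := tendsto_sub_cdf μ Y1 hY1m {ω | S1 ω = 1} mS1 (ϑ * q0 / 2 * μ.real {ω | S1 ω = 1})
    (by positivity)
  -- lower bound
  have low : yq (ϑ * q0 / 2) ≤ m := by
    rw [hyq]
    refine csInf_le ?_ ?_
    · obtain ⟨t, ht⟩ := hsc.1
      refine ⟨t, fun x hx => ?_⟩
      by_contra hlt
      push Not at hlt
      have h1 := hF1mono hlt
      have h2 : F1 t < ϑ * q0 / 2 := by rw [kF, div_lt_iff₀ hp1]; exact ht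
      simp only [mem_ofPred_eq] at hx
      linarith
    · simp only [mem_ofPred_eq]
      rw [kF, le_div_iff₀ hp1]
      have : μ.real ({ω | S0 ω = 1 ∧ S1 ω = 1} ∩ {ω | Y1 ω ≤ m})
          ≤ μ.real ({ω | S1 ω = 1} ∩ {ω | Y1 ω ≤ m}) :=
        measureReal_mono (fun ω h => ⟨h.1.2, h.2⟩)
      linarith
  have up : m ≤ yq (1 - ϑ * q0 / 2) := by
    rw [hyq]
    refine le_csInf ?_ ?_
    · obtain ⟨t, ht⟩ := hsc.2
      refine ⟨t, ?_⟩
      simp only [mem_ofPred_eq]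
      rw [kF, le_div_iff₀ hp1]
      linarith
    · intro t ht
      simp only [mem_ofPred_eq] at ht
      by_contra hlt
      push Not at hlt
      obtain ⟨s, hts, hsm⟩ := exists_between hlt
      have h1 := hF1mono hts
      have h2 : F1 s ≤ 1 - ϑ * q0 / 2 := by
        rw [kF, div_le_iff₀ hp1]
        have hdisj : Disjoint ({ω | S1 ω = 1} ∩ {ω | Y1 ω ≤ s})
            ({ω | S0 ω = 1 ∧ S1 ω = 1} ∩ {ω | m ≤ Y1 ω}) := by
          rw [Set.disjoint_left]
          rintro ω ⟨_, h⟩ ⟨_, h'⟩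
          simp only [mem_ofPred_eq] at h h'
          linarith
        have hu := measureReal_union (μ := μ) hdisj (mAT.inter (hY1m measurableSet_Ici))
        have hle : μ.real (({ω | S1 ω = 1} ∩ {ω | Y1 ω ≤ s}) ∪
            ({ω | S0 ω = 1 ∧ S1 ω = 1} ∩ {ω | m ≤ Y1 ω})) ≤ μ.real {ω | S1 ω = 1} :=
          measureReal_mono (by
            rintro ω (h | h)
            · exact h.1
            · exact h.1.2)
        linarith
      linarith
  -- control mean, part 1: independence of assignment
  have ctrl : ∫ ω in {ω | D ω = 0 ∧ S ω = 1}, Y ω ∂μ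
      = (∫ ω in {ω | S0 ω = 1}, Y0 ω ∂μ) * μ.real {ω | D ω = 0} := by
    have hx : Measurable (fun x : ℝ × ℝ × ℝ × ℝ =>
        Set.indicator {x : ℝ × ℝ × ℝ × ℝ | x.2.2.2 = 1} (fun x => x.2.1) x) :=
      (by fun_prop : Measurable fun x : ℝ × ℝ × ℝ × ℝ => x.2.1).indicator bS0
    have hI : IndepFun (Set.indicator {ω | S0 ω = 1} Y0) D μ := by
      have := hIndep.comp hx measurable_id
      exact this
    have := setInt_indep μ _ D 0 (hY0m.indicator mS0).aestronglyMeasurable hDm hI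
    rw [← integral_indicator mS0, ← this, setIntegral_indicator mS0]
    have e0' : {ω | D ω = 0 ∧ S ω = 1} = {ω | D ω = 0} ∩ {ω | S0 ω = 1} := e0
    rw [e0']
    refine setIntegral_congr_fun (mD0.inter mS0) ?_
    rintro ω ⟨h, h'⟩
    simp only [mem_ofPred_eq] at h h'
    simp [hY, hS, h, h']
  have ctrl' : cexp μ Y {ω | D ω = 0 ∧ S ω = 1}
      = (∫ ω in {ω | S0 ω = 1}, Y0 ω ∂μ) / μ.real {ω | S0 ω = 1} := by
    have e0' : {ω | D ω = 0 ∧ S ω = 1} = {ω | D ω = 0} ∩ {ω | S0 ω = 1} := e0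
    rw [cexp, ctrl, hprr, e0', i0]; field_simp
  -- control mean, part 2: conditional independence
  have hne : μ {ω | S0 ω = 1} ≠ 0 := by
    intro h
    simp [measureReal_def, h] at hp0
  have at0 : (∫ ω in {ω | S0 ω = 1 ∧ S1 ω = 1}, Y0 ω ∂μ)
      = (∫ ω in {ω | S0 ω = 1}, Y0 ω ∂μ) / μ.real {ω | S0 ω = 1}
        * μ.real {ω | S0 ω = 1 ∧ S1 ω = 1} := by
    have : IsProbabilityMeasure (μ[|{ω | S0 ω = 1}]) := cond_isProbabilityMeasure hne
    have hI : IndepFun Y0 S1 (μ[|{ω | S0 ω = 1}]) := hSM2.comp measurable_snd measurable_id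
    have := setInt_indep _ Y0 S1 1 hY0m.aestronglyMeasurable hS1m hI
    rw [measureReal_def _ {ω | S1 ω = 1}, cond_apply mS0, ProbabilityTheory.cond, Measure.restrict_smul, integral_smul_measure,
      integral_smul_measure, Measure.restrict_restrict mS1, Set.inter_comm, ← eAT] at this
    simp only [ENNReal.toReal_inv, ENNReal.toReal_mul, smul_eq_mul, ← measureReal_def] at this
    field_simp at this ⊢
    linarith
  have hτ' : τ = m - cexp μ Y {ω | D ω = 0 ∧ S ω = 1} := by
    rw [hτ, hm, ctrl', cexp, cexp, integral_sub hY1i.integrableOn hY0i.integrableOn, at0, hprr]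
    field_simp
  rw [hτ']
  constructor <;> linarith

end
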